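/- arXiv:1111.5824 — 2 statements merged into one kernel-verified Lean document; each statement's English description precedes it below -/
import Mathlib

section
/- Let (X, μ) be a measure space, let u, v : X → ℝ be measurable functions, and let h_u, h_v : X → [0, ∞) be measurable functions such that for every n > 0 the integrals ∫_{{|u|<n}} h_u dμ and ∫_{{|v|<n}} h_v dμ are finite, and such that (1/n) ∫_{{|u|<n}} h_u dμ → 0 and (1/n) ∫_{{|v|<n}} h_v dμ → 0 as n → +∞. For 0 < k < s define Γ(s,k) = ∫_{{s−k < |u| < s+k}} h_u dμ + ∫_{{s−k < |v| < s+k}} h_v dμ, and for 0 < r < s define Θ(s,r) = ∫_{{s−r < |u| < s}} h_u dμ + ∫_{{s−r < |v| < s}} h_v dμ. Then for every r > 0 one has liminf_{s→+∞} ( limsup_{k→0⁺} (1/k) Γ(s,k) + Θ(s,r) ) = 0. -/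
open MeasureTheory Filter

/-- A nonnegative monotone function with sublinear growth has, arbitrarily far out, points of
differentiability at which both its derivative and its increments of length `r` are small. -/
lemma Monotone.frequently_deriv_add_increment_lt {G : ℝ → ℝ} (hG : Monotone G)
    (hG0 : ∀ t, 0 ≤ G t) (hlim : Tendsto (fun t : ℝ => (1 / t) * G t) atTop (nhds 0))
    {r ε : ℝ} (hr : 0 < r) (hε : 0 < ε) :
    ∃ᶠ s in atTop, DifferentiableAt ℝ G s ∧ 2 * deriv G s + (G s - G (s - r)) < ε := by
  intro hcon
  obtain ⟨a, ha⟩ := eventually_atTop.1 hcon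
  have hint : ∀ x y : ℝ, IntervalIntegrable G volume x y := fun x y => hG.intervalIntegrable
  have key : ∀ b, a ≤ b → ε * (b - a) ≤ (2 + r) * G b := by
    intro b hab
    have hshift : IntervalIntegrable (fun s => G (s - r)) volume a b :=
      (hG.comp (fun x y h => sub_le_sub_right h r)).intervalIntegrable
    have hderiv : IntervalIntegrable (deriv G) volume a b :=
      (hG.monotoneOn _).intervalIntegrable_deriv
    have hle : ∫ _ in a..b, ε ≤ ∫ s in a..b, (2 * deriv G s + (G s - G (s - r))) := by
      refine intervalIntegral.integral_mono_ae_restrict hab (by simp)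
        ((hderiv.const_mul 2).add ((hint a b).sub hshift)) ?_
      rw [EventuallyLE, ae_restrict_iff' measurableSet_Icc]
      filter_upwards [hG.ae_differentiableAt] with s hs hsm
      by_contra! h
      exact ha s hsm.1 ⟨hs, h⟩
    rw [intervalIntegral.integral_add (hderiv.const_mul 2) ((hint a b).sub hshift),
      intervalIntegral.integral_sub (hint a b) hshift, intervalIntegral.integral_const_mul,
      intervalIntegral.integral_comp_sub_right G r,
      intervalIntegral.integral_interval_sub_interval_comm' (hint _ _) (hint _ _) (hint _ _),
      intervalIntegral.integral_const, smul_eq_mul] at hle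
    have h1 : ∫ s in a..b, deriv G s ≤ G b - G a := by
      have := (hG.monotoneOn (Set.uIcc a b)).intervalIntegral_deriv_mem_uIcc
      rw [Set.uIcc_of_le (sub_nonneg.2 (hG hab))] at this
      exact this.2
    have h2 : ∫ s in (b - r)..b, G s ≤ r * G b := by
      have := intervalIntegral.integral_mono_on (by linarith : b - r ≤ b) (hint _ _)
        (intervalIntegrable_const (c := G b)) (fun s hs => hG hs.2)
      simpa using this
    have h3 : 0 ≤ ∫ s in (a - r)..a, G s :=
      intervalIntegral.integral_nonneg (by linarith) fun s _ => hG0 s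
    nlinarith [hG0 a]
  have hsmall : ∀ᶠ t in atTop, (1 / t) * G t < ε / (2 * (2 + r)) :=
    hlim.eventually_lt_const (by positivity)
  obtain ⟨b, hb, hba, hb2, hb0⟩ := (hsmall.and ((eventually_ge_atTop a).and
    ((eventually_ge_atTop (2 * a)).and (eventually_gt_atTop 0)))).exists
  have hk := key b hba
  rw [one_div, inv_mul_lt_iff₀ hb0, mul_div_assoc', lt_div_iff₀ (by positivity)] at hb
  nlinarith

/-- The limsup of an eventually nonnegative real function is nonnegative, whether or not the
function is bounded above. -/
lemma Real.limsup_nonneg_of_eventually {α : Type*} {f : Filter α} [f.NeBot] {g : α → ℝ}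
    (hg : ∀ᶠ x in f, 0 ≤ g x) : 0 ≤ limsup g f := by
  rw [limsup_eq]
  refine Real.sInf_nonneg fun a ha => ?_
  obtain ⟨x, hx, hxa⟩ := (hg.and ha).exists
  exact hx.trans hxa

/-- The limsup of symmetric difference quotients bounds that of any smaller nonnegative
function. -/
lemma limsup_le_two_mul_deriv {G Γ : ℝ → ℝ} {s : ℝ} (hG : DifferentiableAt ℝ G s)
    (hΓ0 : ∀ k, 0 ≤ Γ k) (hΓ : ∀ k, 0 < k → Γ k ≤ G (s + k) - G (s - k)) :
    limsup (fun k => (1 / k) * Γ k) (nhdsWithin 0 (Set.Ioi 0)) ≤ 2 * deriv G s := by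
  have hd : HasDerivAt (fun k => G (s + k) - G (s - k)) (2 * deriv G s) 0 := by
    have h1 : HasDerivAt (fun k => G (s + k)) (deriv G s) 0 :=
      HasDerivAt.comp_const_add s 0 (by simpa using hG.hasDerivAt)
    have h2 : HasDerivAt (fun k => G (s - k)) (-deriv G s) 0 :=
      HasDerivAt.comp_const_sub s 0 (by simpa using hG.hasDerivAt)
    exact (h1.sub h2).congr_deriv (by ring)
  have ht : Tendsto (fun k => (1 / k) * (G (s + k) - G (s - k)))
      (nhdsWithin 0 (Set.Ioi 0)) (nhds (2 * deriv G s)) := by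
    simpa using hd.tendsto_slope_zero_right
  rw [← ht.limsup_eq]
  refine limsup_le_limsup ?_ ?_ ht.isBoundedUnder_le
  · filter_upwards [self_mem_nhdsWithin] with k hk
    have hk' : 0 < k := hk
    exact mul_le_mul_of_nonneg_left (hΓ k hk') (by positivity)
  · refine IsBoundedUnder.isCoboundedUnder_le ⟨0, ?_⟩
    rw [eventually_map]
    filter_upwards [self_mem_nhdsWithin] with k hk
    have hk' : 0 < k := hk
    exact mul_nonneg (by positivity) (hΓ0 k)

section Sublevel

variable {X : Type*} [MeasurableSpace X] {μ : Measure X} {w h : X → ℝ}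

lemma integrableOn_abs_lt (hint : ∀ n : ℝ, 0 < n → IntegrableOn h {x | |w x| < n} μ) (t : ℝ) :
    IntegrableOn h {x | |w x| < t} μ :=
  (hint (max t 1) (by positivity)).mono_set fun _ hx => lt_of_lt_of_le hx (le_max_left t 1)

lemma monotone_setIntegral_abs_lt (h0 : ∀ x, 0 ≤ h x)
    (hint : ∀ n : ℝ, 0 < n → IntegrableOn h {x | |w x| < n} μ) :
    Monotone fun t : ℝ => ∫ x in {x | |w x| < t}, h x ∂μ := fun _ b hab =>
  setIntegral_mono_set (integrableOn_abs_lt hint b) (ae_of_all _ h0)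
    (Eventually.of_forall fun _ hx => lt_of_lt_of_le hx hab)

lemma setIntegral_abs_mem_Ioo_le (hw : Measurable w) (h0 : ∀ x, 0 ≤ h x)
    (hint : ∀ n : ℝ, 0 < n → IntegrableOn h {x | |w x| < n} μ) {a b : ℝ} (hab : a ≤ b) :
    ∫ x in {x | a < |w x| ∧ |w x| < b}, h x ∂μ ≤
      (∫ x in {x | |w x| < b}, h x ∂μ) - ∫ x in {x | |w x| < a}, h x ∂μ := by
  have hsub : {x | |w x| < a} ⊆ {x | |w x| < b} := fun _ hx => lt_of_lt_of_le hx hab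
  have hmeas : MeasurableSet {x | |w x| < a} := measurableSet_lt hw.abs measurable_const
  rw [← setIntegral_sdiff hmeas (integrableOn_abs_lt hint b) hsub]
  exact setIntegral_mono_set ((integrableOn_abs_lt hint b).mono_set Set.sdiff_subset)
    (ae_of_all _ h0) (Eventually.of_forall fun _ hx => ⟨hx.2, not_lt.2 hx.1.le⟩)

end Sublevel

/-- Lemma 4.1 of the paper (measure-theoretic content): if the Cesàro means
of the integrals of `hU` over `{|u| < n}` and of `hV` over `{|v| < n}` vanish,
then for every `r > 0` the liminf as `s → +∞` of
`limsup_{k→0⁺} (1/k) Γ(s,k) + Θ(s,r)` is zero. -/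
theorem stmt0 {X : Type*} [MeasurableSpace X] (μ : Measure X)
    (u v : X → ℝ) (hu : Measurable u) (hv : Measurable v)
    (hU hV : X → ℝ) (hhU : Measurable hU) (hhV : Measurable hV)
    (hU0 : ∀ x, 0 ≤ hU x) (hV0 : ∀ x, 0 ≤ hV x)
    (hUint : ∀ n : ℝ, 0 < n → IntegrableOn hU {x | |u x| < n} μ)
    (hVint : ∀ n : ℝ, 0 < n → IntegrableOn hV {x | |v x| < n} μ)
    (hUlim : Tendsto (fun n : ℝ => (1 / n) * ∫ x in {x | |u x| < n}, hU x ∂μ)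
      atTop (nhds 0))
    (hVlim : Tendsto (fun n : ℝ => (1 / n) * ∫ x in {x | |v x| < n}, hV x ∂μ)
      atTop (nhds 0)) :
    ∀ r > (0 : ℝ),
      liminf (fun s : ℝ =>
        limsup (fun k : ℝ =>
          (1 / k) * ((∫ x in {x | s - k < |u x| ∧ |u x| < s + k}, hU x ∂μ)
            + ∫ x in {x | s - k < |v x| ∧ |v x| < s + k}, hV x ∂μ))
          (nhdsWithin 0 (Set.Ioi 0))
        + ((∫ x in {x | s - r < |u x| ∧ |u x| < s}, hU x ∂μ)
            + ∫ x in {x | s - r < |v x| ∧ |v x| < s}, hV x ∂μ))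
        atTop = 0 := by
  intro r hr
  set G : ℝ → ℝ := fun t =>
    (∫ x in {x | |u x| < t}, hU x ∂μ) + ∫ x in {x | |v x| < t}, hV x ∂μ with hGdef
  have hG : Monotone G :=
    (monotone_setIntegral_abs_lt hU0 hUint).add (monotone_setIntegral_abs_lt hV0 hVint)
  have hG0 : ∀ t, 0 ≤ G t := fun t => add_nonneg (integral_nonneg hU0) (integral_nonneg hV0)
  have hlim : Tendsto (fun t : ℝ => (1 / t) * G t) atTop (nhds 0) := by
    simpa [hGdef, mul_add] using hUlim.add hVlim
  have hIoo0 : ∀ a b : ℝ, 0 ≤ (∫ x in {x | a < |u x| ∧ |u x| < b}, hU x ∂μ)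
      + ∫ x in {x | a < |v x| ∧ |v x| < b}, hV x ∂μ := fun a b =>
    add_nonneg (integral_nonneg hU0) (integral_nonneg hV0)
  have hIoo : ∀ a b : ℝ, a ≤ b → (∫ x in {x | a < |u x| ∧ |u x| < b}, hU x ∂μ)
      + ∫ x in {x | a < |v x| ∧ |v x| < b}, hV x ∂μ ≤ G b - G a := fun a b hab => by
    have h1 := setIntegral_abs_mem_Ioo_le hu hU0 hUint hab
    have h2 := setIntegral_abs_mem_Ioo_le hv hV0 hVint hab
    simp only [hGdef]
    linarith
  rw [liminf_eq]
  refine IsGreatest.csSup_eq ⟨Eventually.of_forall fun s => ?_, fun a ha => ?_⟩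
  · refine add_nonneg (Real.limsup_nonneg_of_eventually ?_) (hIoo0 _ _)
    filter_upwards [self_mem_nhdsWithin] with k hk
    have hk' : 0 < k := hk
    exact mul_nonneg (by positivity) (hIoo0 _ _)
  · by_contra! hapos
    obtain ⟨s, ⟨hdiff, hlt⟩, has⟩ :=
      ((hG.frequently_deriv_add_increment_lt hG0 hlim hr hapos).and_eventually ha).exists
    have h1 := limsup_le_two_mul_deriv hdiff (fun k => hIoo0 (s - k) (s + k))
      fun k hk => hIoo (s - k) (s + k) (by linarith)
    have h2 := hIoo (s - r) s (by linarith)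
    linarith
end

section
/- Let F : ℝ → ℝ be nondecreasing with F(s)/s → 0 as s → +∞, and let Θ : (0, ∞) → [0, ∞) be a measurable, locally integrable function such that (1/s) ∫_0^s Θ(ξ) dξ → 0 as s → +∞. Then liminf_{s→+∞} ( limsup_{k→0⁺} (F(s+k) − F(s−k))/k + Θ(s) ) = 0. -/
open MeasureTheory Filter

lemma HasDerivAt.tendsto_symm_slope {F : ℝ → ℝ} {s d : ℝ} (h : HasDerivAt F d s) :
    Tendsto (fun k : ℝ => (F (s + k) - F (s - k)) / k) (nhdsWithin 0 (Set.Ioi 0))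
      (nhds (2 * d)) := by
  have h₁ : HasDerivAt (fun k : ℝ => F (s + k)) d 0 :=
    HasDerivAt.comp_const_add s 0 (by simpa using h)
  have h₂ : HasDerivAt (fun k : ℝ => F (s - k)) (-d) 0 :=
    HasDerivAt.comp_const_sub s 0 (by simpa using h)
  have h₃ := (h₁.sub h₂).tendsto_slope_zero_right
  rw [sub_neg_eq_add, ← two_mul] at h₃
  simpa [div_eq_inv_mul] using h₃

/-- The upper symmetric slope of a monotone function is nonnegative, including where it is
infinite and the real-valued `limsup` takes its default value. -/
lemma Monotone.limsup_symm_slope_nonneg {F : ℝ → ℝ} (hF : Monotone F) (s : ℝ) :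
    0 ≤ limsup (fun k : ℝ => (F (s + k) - F (s - k)) / k) (nhdsWithin 0 (Set.Ioi 0)) := by
  refine Real.sInf_nonneg fun a ha => ?_
  have ha' : ∀ᶠ k in nhdsWithin (0 : ℝ) (Set.Ioi 0), (F (s + k) - F (s - k)) / k ≤ a := by
    simpa using ha
  obtain ⟨k, hk, hk0⟩ := (ha'.and self_mem_nhdsWithin).exists
  have hk0 : 0 < k := hk0
  exact (div_nonneg (sub_nonneg.2 (hF (by linarith))) hk0.le).trans hk

/-- A linear lower bound on the upper symmetric slope plus `Θ` integrates to a linear lower bound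
on the growth of `2 F + ∫ Θ`. -/
lemma Monotone.mul_sub_le_of_le_limsup_symm_slope_add {F Θ : ℝ → ℝ} (hF : Monotone F)
    {a n t : ℝ} (hnt : n ≤ t) (hΘ : IntervalIntegrable Θ volume n t)
    (h : ∀ s ≥ n, a ≤
      limsup (fun k : ℝ => (F (s + k) - F (s - k)) / k) (nhdsWithin 0 (Set.Ioi 0)) + Θ s) :
    a * (t - n) ≤ 2 * (F t - F n) + ∫ ξ in n..t, Θ ξ := by
  have hmono : MonotoneOn F (Set.uIcc n t) := hF.monotoneOn _
  have hd := hmono.intervalIntegrable_deriv.const_mul 2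
  have hle : (∫ _ in n..t, a) ≤ ∫ ξ in n..t, (2 * deriv F ξ + Θ ξ) := by
    refine intervalIntegral.integral_mono_ae_restrict hnt (by simp) (hd.add hΘ) ?_
    filter_upwards [ae_restrict_of_ae hF.ae_differentiableAt,
      ae_restrict_mem measurableSet_Icc] with s hs hmem
    simpa [hs.hasDerivAt.tendsto_symm_slope.limsup_eq] using h s hmem.1
  rw [intervalIntegral.integral_add hd hΘ, intervalIntegral.integral_const_mul,
    intervalIntegral.integral_const, smul_eq_mul] at hle
  have hderiv := hmono.intervalIntegral_deriv_mem_uIcc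
  rw [Set.uIcc_of_le (sub_nonneg.2 (hF hnt))] at hderiv
  linarith [hderiv.2]

/-- The real-analysis core of the contradiction argument of Lemma 4.1:
if `F` is nondecreasing with `F(s)/s → 0` and `Θ ≥ 0` has vanishing Cesàro mean,
then `liminf_{s→+∞} ( limsup_{k→0⁺} (F(s+k) − F(s−k))/k + Θ(s) ) = 0`. -/
theorem stmt1 (F : ℝ → ℝ) (hF : Monotone F)
    (hFlim : Tendsto (fun s : ℝ => F s / s) atTop (nhds 0))
    (Θ : ℝ → ℝ) (hΘmeas : Measurable Θ)
    (hΘ0 : ∀ s ∈ Set.Ioi (0 : ℝ), 0 ≤ Θ s)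
    (hΘint : ∀ s > (0 : ℝ), IntegrableOn Θ (Set.Ioc 0 s))
    (hΘlim : Tendsto (fun s : ℝ => (1 / s) * ∫ ξ in Set.Ioc (0 : ℝ) s, Θ ξ)
      atTop (nhds 0)) :
    liminf (fun s : ℝ =>
      limsup (fun k : ℝ => (F (s + k) - F (s - k)) / k) (nhdsWithin 0 (Set.Ioi 0))
        + Θ s) atTop = 0 := by
  have hmem : ∀ᶠ s in atTop, 0 ≤
      limsup (fun k : ℝ => (F (s + k) - F (s - k)) / k) (nhdsWithin 0 (Set.Ioi 0)) + Θ s := by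
    filter_upwards [eventually_gt_atTop 0] with s hs
    exact add_nonneg (hF.limsup_symm_slope_nonneg s) (hΘ0 s hs)
  rw [liminf_eq]
  refine IsGreatest.csSup_eq ⟨hmem, fun a ha => ?_⟩
  obtain ⟨n₀, hn₀⟩ := eventually_atTop.1 ha
  obtain ⟨n, hn, hn0⟩ : ∃ n ≥ n₀, 0 < n := ⟨max n₀ 1, le_max_left _ _, by positivity⟩
  have hinv : Tendsto (fun t : ℝ => 1 / t) atTop (nhds 0) := by
    simpa using tendsto_inv_atTop_zero (𝕜 := ℝ)
  have hlim : Tendsto (fun t : ℝ => 2 * (F t / t) + (a * n - 2 * F n) * (1 / t)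
      + (1 / t) * ∫ ξ in Set.Ioc (0 : ℝ) t, Θ ξ) atTop (nhds 0) := by
    simpa using ((hFlim.const_mul 2).add (hinv.const_mul (a * n - 2 * F n))).add hΘlim
  refine ge_of_tendsto hlim ?_
  filter_upwards [eventually_ge_atTop n] with t ht
  have ht0 : 0 < t := hn0.trans_le ht
  have hsub : Set.Ioc n t ⊆ Set.Ioc 0 t := Set.Ioc_subset_Ioc_left hn0.le
  have hgrowth := hF.mul_sub_le_of_le_limsup_symm_slope_add ht
    ((intervalIntegrable_iff_integrableOn_Ioc_of_le ht).2 ((hΘint t ht0).mono_set hsub))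
    fun s hs => hn₀ s (hn.trans hs)
  have hΘle : ∫ ξ in n..t, Θ ξ ≤ ∫ ξ in Set.Ioc (0 : ℝ) t, Θ ξ := by
    rw [intervalIntegral.integral_of_le ht]
    refine setIntegral_mono_set (hΘint t ht0) ?_ hsub.eventuallyLE
    filter_upwards [ae_restrict_mem measurableSet_Ioc] with s hs using hΘ0 s hs.1
  have hkey : a ≤ (2 * F t + (a * n - 2 * F n) + ∫ ξ in Set.Ioc (0 : ℝ) t, Θ ξ) / t := by
    rw [le_div_iff₀ ht0]
    linarith
  exact hkey.trans_eq (by ring)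
end
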